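/- Under the exclusive policy, for every distribution f and horizon T, every profile P of k strategies at equilibrium, and every profile P′ of k strategies, success(P′) ≤ (1 − (1 − 1/k)^k)^{−1} · success(P); equivalently, the price of anarchy of the exclusive policy is at most (1 − (1 − 1/k)^k)^{−1}. -/

import Mathlib

open Finset

/-- `A` is a doubly-substochastic `M × T` matrix: boxes `1..M`, rounds `1..T`,
nonnegative entries, every row and every column sums to at most 1. -/
def Substochastic (M T : ℕ) (A : ℕ → ℕ → ℝ) : Prop :=
  (∀ x t, 0 ≤ A x t) ∧
  (∀ x ∈ Icc 1 M, ∑ t ∈ Icc 1 T, A x t ≤ 1) ∧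
  (∀ t ∈ Icc 1 T, ∑ x ∈ Icc 1 M, A x t ≤ 1)

/-- `N̄_A(x,t)`: the probability that `A` does not visit box `x` by (and including) round `t`. -/
def Nbar (A : ℕ → ℕ → ℝ) (x t : ℕ) : ℝ := 1 - ∑ s ∈ Icc 1 t, A x s

/-- `f` is a positive, nonincreasing probability distribution on boxes `1..M`. -/
def BoxDist (M : ℕ) (f : ℕ → ℝ) : Prop :=
  (∀ x ∈ Icc 1 M, 0 < f x) ∧
  (∀ x, 1 ≤ x → x + 1 ≤ M → f (x + 1) ≤ f x) ∧
  (∑ x ∈ Icc 1 M, f x = 1)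

/-- `C` is a congestion policy for `k` players: nonnegative, nonincreasing on `1..k`,
`C 1 = 1`, and `C ℓ < 1` for some `ℓ ≤ k`. -/
def Policy (k : ℕ) (C : ℕ → ℝ) : Prop :=
  (∀ ℓ, 1 ≤ ℓ → ℓ ≤ k → 0 ≤ C ℓ) ∧ (C 1 = 1) ∧
  (∀ ℓ ℓ', 1 ≤ ℓ → ℓ ≤ ℓ' → ℓ' ≤ k → C ℓ' ≤ C ℓ) ∧
  (∃ ℓ, 1 ≤ ℓ ∧ ℓ ≤ k ∧ C ℓ < 1)

/-- The value of box `x` at round `t` against `k-1` copies of `A`. -/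
def val (k : ℕ) (C f : ℕ → ℝ) (A : ℕ → ℕ → ℝ) (x t : ℕ) : ℝ :=
  f x * ∑ ℓ ∈ range k,
    C (ℓ + 1) * ((k - 1).choose ℓ : ℝ) * A x t ^ ℓ * Nbar A x t ^ (k - 1 - ℓ)

/-- The utility of `B` against `k-1` copies of `A`. -/
def util (M T k : ℕ) (C f : ℕ → ℝ) (A B : ℕ → ℕ → ℝ) : ℝ :=
  ∑ t ∈ Icc 1 T, ∑ x ∈ Icc 1 M, B x t * val k C f A x t

/-- `A` is non-redundant: each column `t ≤ min T M` sums to exactly 1. -/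
def NonRedundant (M T : ℕ) (A : ℕ → ℕ → ℝ) : Prop :=
  ∀ t, 1 ≤ t → t ≤ min T M → ∑ x ∈ Icc 1 M, A x t = 1

/-- `A` is self-greedy: for each round `t ≤ T` it is greedy at round `t` with respect to
`k-1` copies of itself. -/
def SGreedy (M T k : ℕ) (C f : ℕ → ℝ) (A : ℕ → ℕ → ℝ) : Prop :=
  ∀ t, 1 ≤ t → t ≤ T → ∀ B, Substochastic M T B →
    (∀ x s, s < t → B x s = A x s) →
    ∑ x ∈ Icc 1 M, B x t * val k C f A x t ≤ ∑ x ∈ Icc 1 M, A x t * val k C f A x t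

noncomputable instance : DecidableEq (ℕ → ℕ → ℝ) := Classical.decEq _

/-- The value of box `x` at round `t` against the profile `P` under the exclusive policy. -/
def pexVal (f : ℕ → ℝ) (P : Multiset (ℕ → ℕ → ℝ)) (x t : ℕ) : ℝ :=
  f x * (P.map fun A => Nbar A x t).prod

/-- The utility of `B` against the profile `P` under the exclusive policy. -/
def pexUtil (M T : ℕ) (f : ℕ → ℝ) (P : Multiset (ℕ → ℕ → ℝ)) (B : ℕ → ℕ → ℝ) : ℝ :=
  ∑ t ∈ Icc 1 T, ∑ x ∈ Icc 1 M, B x t * pexVal f P x t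

/-- The success probability of the profile `P`. -/
def success (M T : ℕ) (f : ℕ → ℝ) (P : Multiset (ℕ → ℕ → ℝ)) : ℝ :=
  ∑ x ∈ Icc 1 M, f x * (1 - (P.map fun A => Nbar A x T).prod)

/-- A product of nonnegative sums dominates the terms of degree at most one in the increments. -/
lemma prod_add_sum_mul_prod_erase_le {ι : Type*} [DecidableEq ι] (s : Finset ι) (z e : ι → ℝ)
    (hz : ∀ i ∈ s, 0 ≤ z i) (he : ∀ i ∈ s, 0 ≤ e i) :
    ∏ i ∈ s, z i + ∑ i ∈ s, e i * ∏ j ∈ s.erase i, z j ≤ ∏ i ∈ s, (z i + e i) := by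
  induction s using Finset.induction_on with
  | empty => simp
  | insert a s ha ih =>
    have ih := ih (fun i hi => hz i (mem_insert_of_mem hi)) (fun i hi => he i (mem_insert_of_mem hi))
    have hza := hz a (mem_insert_self _ _)
    have hea := he a (mem_insert_self _ _)
    rw [prod_insert ha, prod_insert ha, sum_insert ha, erase_insert ha]
    have hsum : ∑ i ∈ s, e i * ∏ j ∈ (insert a s).erase i, z j
        = z a * ∑ i ∈ s, e i * ∏ j ∈ s.erase i, z j := by
      rw [mul_sum]
      refine sum_congr rfl fun i hi => ?_
      rw [erase_insert_of_ne (by rintro rfl; exact ha hi), prod_insert (by simp [ha])]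
      ring
    have hmono : ∏ i ∈ s, z i ≤ ∏ i ∈ s, (z i + e i) :=
      prod_le_prod (fun i hi => hz i (mem_insert_of_mem hi))
        (fun i hi => le_add_of_nonneg_right (he i (mem_insert_of_mem hi)))
    rw [hsum]
    nlinarith [mul_le_mul_of_nonneg_left ih hza, mul_le_mul_of_nonneg_left hmono hea]

/-- The AM-GM inequality for `k` nonnegative numbers with sum `k - 1`. -/
lemma prod_le_one_sub_inv_pow {k : ℕ} (hk : 1 ≤ k) (z : Fin k → ℝ) (hz : ∀ i, 0 ≤ z i)
    (hsum : ∑ i, z i = (k : ℝ) - 1) : ∏ i, z i ≤ (1 - 1 / (k : ℝ)) ^ k := by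
  have hk0 : (0 : ℝ) < k := by exact_mod_cast hk
  have h := Real.geom_mean_le_arith_mean_weighted univ (fun _ : Fin k => 1 / (k : ℝ)) z
    (fun _ _ => by positivity) (by simp [hk0.ne']) fun i _ => hz i
  rw [← mul_sum, hsum, Real.finsetProd_rpow _ _ fun i _ => hz i] at h
  have h' := pow_le_pow_left₀ (Real.rpow_nonneg (prod_nonneg fun i _ => hz i) _) h k
  rw [one_div, Real.rpow_inv_natCast_pow (prod_nonneg fun i _ => hz i) (by omega)] at h'
  rwa [show (k : ℝ)⁻¹ * (k - 1) = 1 - 1 / k by field_simp] at h'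

/-- If `i` is one of `k` players, and `y j` is the probability that `j` misses the box, then
the probability that the others all miss it, times their expected number of visits, is small. -/
lemma prod_erase_mul_sum_le {k : ℕ} (hk : 1 ≤ k) (y : Fin k → ℝ) (hy : ∀ i, 0 ≤ y i)
    (hy1 : ∀ i, y i ≤ 1) (i : Fin k) :
    (∏ j ∈ univ.erase i, y j) * ∑ j ∈ univ.erase i, (1 - y j) ≤ (1 - 1 / (k : ℝ)) ^ k := by
  set σ := ∑ j ∈ univ.erase i, (1 - y j) with hσ
  have hσ0 : 0 ≤ σ := sum_nonneg fun j _ => by linarith [hy1 j]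
  have h := prod_le_one_sub_inv_pow hk (Function.update y i σ)
    (fun j => by by_cases hj : j = i <;> simp [hj, hσ0, hy]) (by
      rw [sum_update_of_mem (mem_univ i), ← erase_eq, hσ, sum_sub_distrib]
      simp [card_erase_of_mem]
      rw [Nat.cast_sub hk]; simp)
  rwa [prod_update_of_mem (mem_univ i), ← erase_eq, mul_comm] at h

lemma Nbar_succ (A : ℕ → ℕ → ℝ) (x t : ℕ) : Nbar A x (t + 1) = Nbar A x t - A x (t + 1) := by
  simp only [Nbar]
  rw [sum_Icc_succ_top (by omega)]
  ring

lemma Nbar_antitone {A : ℕ → ℕ → ℝ} (hA : ∀ x t, 0 ≤ A x t) (x : ℕ) : Antitone (Nbar A x) :=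
  antitone_nat_of_succ_le fun t => by rw [Nbar_succ]; linarith [hA x (t + 1)]

lemma Nbar_le_one {A : ℕ → ℕ → ℝ} (hA : ∀ x t, 0 ≤ A x t) (x t : ℕ) : Nbar A x t ≤ 1 := by
  have := sum_nonneg fun s (_ : s ∈ Icc 1 t) => hA x s
  simp only [Nbar]; linarith

section Box

variable {k : ℕ} {F : Fin k → ℕ → ℕ → ℝ} {x : ℕ}

lemma prod_Nbar_succ_add_le (hF : ∀ i x t, 0 ≤ F i x t) {t : ℕ}
    (hN : ∀ i, 0 ≤ Nbar (F i) x (t + 1)) {θ : ℝ} (hθ : θ ≤ 1) :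
    ∏ i, Nbar (F i) x (t + 1)
      + ∑ i, (1 - θ) * F i x (t + 1) * ∏ j ∈ univ.erase i, Nbar (F j) x (t + 1)
      ≤ ∏ i, (Nbar (F i) x t - θ * F i x (t + 1)) := by
  refine (prod_add_sum_mul_prod_erase_le univ _ (fun i => (1 - θ) * F i x (t + 1))
    (fun i _ => hN i) fun i _ => mul_nonneg (by linarith) (hF i x _)).trans_eq ?_
  refine prod_congr rfl fun i _ => ?_
  rw [Nbar_succ]
  ring

/-- The probability that some round has a lone first visitor is at most the probability of a
visit. -/
lemma sum_mul_prod_erase_Nbar_le (hF : ∀ i x t, 0 ≤ F i x t) (T : ℕ)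
    (hN : ∀ i, 0 ≤ Nbar (F i) x T) :
    ∑ t ∈ Icc 1 T, ∑ i, F i x t * ∏ j ∈ univ.erase i, Nbar (F j) x t
      ≤ 1 - ∏ i, Nbar (F i) x T := by
  induction T with
  | zero => simp [Nbar]
  | succ T ih =>
    have ih := ih fun i => (hN i).trans (Nbar_antitone (hF i) x T.le_succ)
    have h := prod_Nbar_succ_add_le hF hN zero_le_one
    simp only [sub_zero, one_mul, zero_mul] at h
    rw [sum_Icc_succ_top (by omega)]
    linarith

/-- Visits to a box can be truncated in time so that their expected number is capped at one, the
value of the dropped visits being at most the decrease of the visiting probability. -/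
lemma exists_truncation (hF : ∀ i x t, 0 ≤ F i x t) (T : ℕ)
    (hN : ∀ i, 0 ≤ Nbar (F i) x T) :
    ∃ h : ℕ → ℝ, (∀ t, 0 ≤ h t) ∧ (∀ t, h t ≤ 1) ∧
      (∑ t ∈ Icc 1 T, ∑ i, h t * F i x t = min 1 (∑ t ∈ Icc 1 T, ∑ i, F i x t)) ∧
      (∑ t ∈ Icc 1 T, ∑ i, F i x t ≤ 1 → ∀ t, h t = 1) ∧
      ∑ t ∈ Icc 1 T, ∑ i, (1 - h t) * F i x t * ∏ j ∈ univ.erase i, Nbar (F j) x t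
        ≤ ∏ i, (1 - ∑ t ∈ Icc 1 T, h t * F i x t) - ∏ i, Nbar (F i) x T := by
  by_cases hq : ∑ t ∈ Icc 1 T, ∑ i, F i x t ≤ 1
  · refine ⟨fun _ => 1, by simp, by simp, by simp [hq], by simp, by simp [Nbar]⟩
  induction T with
  | zero => simp at hq
  | succ T ih =>
    have hstep := fun θ hθ => prod_Nbar_succ_add_le (θ := θ) hF hN hθ
    have ih := ih fun i => (hN i).trans (Nbar_antitone (hF i) x T.le_succ)
    have hlt : ∀ t ∈ Icc 1 T, t ≤ T := fun t ht => (mem_Icc.1 ht).2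
    by_cases hqT : ∑ t ∈ Icc 1 T, ∑ i, F i x t ≤ 1
    · set q := ∑ t ∈ Icc 1 T, ∑ i, F i x t with hqdef
      rw [sum_Icc_succ_top (by omega), ← hqdef, not_le] at hq
      set d := ∑ i, F i x (T + 1) with hd
      have hd0 : 0 < d := by linarith
      have hθ1 : (1 - q) / d ≤ 1 := by rw [div_le_one hd0]; linarith
      have hθ0 : 0 ≤ (1 - q) / d := div_nonneg (by linarith) hd0.le
      have hθd : (1 - q) / d * d = 1 - q := div_mul_cancel₀ _ hd0.ne'
      set θ := (1 - q) / d
      have hcongr : ∀ g : ℕ → ℝ → ℝ,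
          ∑ t ∈ Icc 1 T, g t (if t ≤ T then 1 else θ) = ∑ t ∈ Icc 1 T, g t 1 :=
        fun g => sum_congr rfl fun t ht => by rw [if_pos (hlt t ht)]
      refine ⟨fun t => if t ≤ T then 1 else θ, ?_, ?_, ?_, ?_, ?_⟩
      · intro t; dsimp only; split_ifs <;> linarith
      · intro t; dsimp only; split_ifs <;> linarith
      · rw [sum_Icc_succ_top (by omega), sum_Icc_succ_top (by omega),
          hcongr fun t y => ∑ i, y * F i x t]
        simp only [one_mul, Nat.not_succ_le_self, if_false, ← mul_sum, ← hqdef, ← hd]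
        rw [min_eq_left hq.le, hθd]
        ring
      · intro h
        rw [sum_Icc_succ_top (by omega)] at h
        linarith
      · rw [sum_Icc_succ_top (by omega),
          hcongr fun t y => ∑ i, (1 - y) * F i x t * ∏ j ∈ univ.erase i, Nbar (F j) x t]
        have h := hstep θ hθ1
        have hprod : ∏ i, (1 - ∑ t ∈ Icc 1 (T + 1), (if t ≤ T then 1 else θ) * F i x t)
            = ∏ i, (Nbar (F i) x T - θ * F i x (T + 1)) := by
          refine prod_congr rfl fun i _ => ?_
          rw [sum_Icc_succ_top (by omega), hcongr fun t y => y * F i x t]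
          simp [Nbar]
          ring
        rw [hprod]
        simp only [sub_self, zero_mul, sum_const_zero, Nat.not_succ_le_self, if_false, zero_add]
        linarith
    · obtain ⟨h, h0, h1, hm, -, hv⟩ := ih hqT
      have hcongr : ∀ g : ℕ → ℝ → ℝ,
          ∑ t ∈ Icc 1 T, g t (if t ≤ T then h t else 0) = ∑ t ∈ Icc 1 T, g t (h t) :=
        fun g => sum_congr rfl fun t ht => by rw [if_pos (hlt t ht)]
      refine ⟨fun t => if t ≤ T then h t else 0, ?_, ?_, ?_, fun h => absurd h hq, ?_⟩
      · intro t; dsimp only; split_ifs <;> simp [h0]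
      · intro t; dsimp only; split_ifs <;> simp [h1]
      · rw [min_eq_left (not_le.1 hqT).le] at hm
        rw [min_eq_left (not_le.1 hq).le, sum_Icc_succ_top (by omega),
          hcongr fun t y => ∑ i, y * F i x t, hm]
        simp
      · rw [sum_Icc_succ_top (by omega),
          hcongr fun t y => ∑ i, (1 - y) * F i x t * ∏ j ∈ univ.erase i, Nbar (F j) x t]
        have hlast := hstep 0 zero_le_one
        have hprod : ∏ i, (1 - ∑ t ∈ Icc 1 (T + 1), (if t ≤ T then h t else 0) * F i x t)
            = ∏ i, (1 - ∑ t ∈ Icc 1 T, h t * F i x t) := by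
          refine prod_congr rfl fun i _ => ?_
          rw [sum_Icc_succ_top (by omega), hcongr fun t y => y * F i x t]
          simp
        rw [hprod]
        simp only [Nat.not_succ_le_self, if_false]
        simp only [zero_mul, sub_zero] at hlast ⊢
        linarith

/-- Single-box estimate: keep a fraction `r` of the truncated visits of each player, and spread
`r` times the missing expected visits according to `β`. The value lost by this deviation is at most
the visiting probability minus `(1 - (1 - 1 / k) ^ k) * r`. -/
lemma exists_box_deviation (hk : 1 ≤ k) (hF : ∀ i x t, 0 ≤ F i x t) (T : ℕ)
    (hN : ∀ i, 0 ≤ Nbar (F i) x T) :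
    ∃ h : ℕ → ℝ, (∀ t, 0 ≤ h t) ∧ (∀ t, h t ≤ 1) ∧
      (∑ t ∈ Icc 1 T, ∑ i, h t * F i x t ≤ 1) ∧
      ∀ (r : ℝ) (β : Fin k → ℕ → ℝ), 0 ≤ r → r ≤ 1 → (∀ i, ∀ t ∈ Icc 1 T, 0 ≤ β i t) →
        (r * (1 - ∑ t ∈ Icc 1 T, ∑ i, h t * F i x t) ≠ 0 → ∑ t ∈ Icc 1 T, ∑ i, β i t = 1) →
        ∑ t ∈ Icc 1 T, ∑ i, (F i x t - (r * (h t * F i x t)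
            + r * (1 - ∑ t ∈ Icc 1 T, ∑ i, h t * F i x t) * β i t))
              * ∏ j ∈ univ.erase i, Nbar (F j) x t
          ≤ 1 - ∏ i, Nbar (F i) x T - (1 - (1 - 1 / (k : ℝ)) ^ k) * r := by
  obtain ⟨h, h0, h1, hm, hone, hv⟩ := exists_truncation hF T hN
  refine ⟨h, h0, h1, hm.trans_le (min_le_left _ _), fun r β hr0 hr1 hβ hβ1 => ?_⟩
  set m := ∑ t ∈ Icc 1 T, ∑ i, h t * F i x t with hmdef
  set W : Fin k → ℕ → ℝ := fun i t => ∏ j ∈ univ.erase i, Nbar (F j) x t with hW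
  have hfirst := sum_mul_prod_erase_Nbar_le hF T hN
  have hsplit : ∑ t ∈ Icc 1 T, ∑ i, (F i x t - (r * (h t * F i x t) + r * (1 - m) * β i t)) * W i t
      = (1 - r) * ∑ t ∈ Icc 1 T, ∑ i, F i x t * W i t
        + (r * ∑ t ∈ Icc 1 T, ∑ i, (1 - h t) * F i x t * W i t
          - r * (1 - m) * ∑ t ∈ Icc 1 T, ∑ i, β i t * W i t) := by
    simp only [mul_sum, ← sum_add_distrib, ← sum_sub_distrib]
    refine sum_congr rfl fun t _ => sum_congr rfl fun i _ => ?_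
    ring
  suffices hsecond : r * ∑ t ∈ Icc 1 T, ∑ i, (1 - h t) * F i x t * W i t
      - r * (1 - m) * ∑ t ∈ Icc 1 T, ∑ i, β i t * W i t
      ≤ r * ((1 - 1 / (k : ℝ)) ^ k - ∏ i, Nbar (F i) x T) by
    rw [hsplit]
    nlinarith [mul_le_mul_of_nonneg_left hfirst (sub_nonneg.2 hr1)]
  rcases hr0.eq_or_lt with rfl | hr
  · simp
  rw [mul_assoc, ← mul_sub]
  refine mul_le_mul_of_nonneg_left ?_ hr0
  by_cases hm1 : m = 1
  · have hH : ∏ i, (1 - ∑ t ∈ Icc 1 T, h t * F i x t) ≤ (1 - 1 / (k : ℝ)) ^ k := by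
      refine prod_le_one_sub_inv_pow hk _ (fun i => (hN i).trans ?_) ?_
      · simp only [Nbar]
        gcongr with t
        exact mul_le_of_le_one_left (hF i x t) (h1 t)
      · rw [sum_sub_distrib, sum_comm, ← hmdef, hm1]
        simp
    rw [hm1]
    linarith
  · have hmle : m ≤ 1 := hm.trans_le (min_le_left _ _)
    have hq : ∑ t ∈ Icc 1 T, ∑ i, F i x t ≤ 1 := by
      by_contra hq
      exact hm1 (hm.trans (min_eq_left (not_le.1 hq).le))
    have hβ1 := hβ1 (mul_ne_zero hr.ne' (sub_ne_zero.2 (Ne.symm hm1)))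
    rw [min_eq_right hq] at hm
    have hpoint : ∀ i, ∏ j, Nbar (F j) x T - (1 - m) * W i T ≤ (1 - 1 / (k : ℝ)) ^ k := by
      intro i
      refine le_trans (le_of_eq ?_) (prod_erase_mul_sum_le hk (fun j => Nbar (F j) x T) hN
        (fun j => Nbar_le_one (hF j) x T) i)
      have hms : m = ∑ j, (1 - Nbar (F j) x T) := by
        rw [hm, sum_comm]
        simp [Nbar]
      rw [hms, ← mul_prod_erase univ _ (mem_univ i), ← add_sum_erase univ _ (mem_univ i)]
      ring
    have hW : ∀ i, ∀ t ∈ Icc 1 T, W i T ≤ W i t := fun i t ht =>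
      prod_le_prod (fun j _ => hN j) fun j _ => Nbar_antitone (hF j) x (mem_Icc.1 ht).2
    have hsum : ∑ t ∈ Icc 1 T, ∑ i, β i t * (∏ j, Nbar (F j) x T - (1 - m) * W i t)
        ≤ ∑ t ∈ Icc 1 T, ∑ i, β i t * (1 - 1 / (k : ℝ)) ^ k := by
      gcongr with t ht i _
      · exact hβ i t ht
      · exact le_trans (sub_le_sub_left
          (mul_le_mul_of_nonneg_left (hW i t ht) (sub_nonneg.2 hmle)) _) (hpoint i)
    simp only [← sum_mul, hβ1, mul_sub, sum_sub_distrib, one_mul] at hsum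
    have hcomm : ∑ t ∈ Icc 1 T, ∑ i, β i t * ((1 - m) * W i t)
        = (1 - m) * ∑ t ∈ Icc 1 T, ∑ i, β i t * W i t := by
      simp only [mul_sum]
      exact sum_congr rfl fun t _ => sum_congr rfl fun i _ => by ring
    have hzero : ∀ t, h t = 1 := hone hq
    simp only [hzero, sub_self, zero_mul, sum_const_zero]
    linarith

end Box

lemma one_sub_prod_le_sum {ι : Type*} (s : Finset ι) (y : ι → ℝ) (hy : ∀ i ∈ s, 0 ≤ y i)
    (hy1 : ∀ i ∈ s, y i ≤ 1) : 1 - ∏ i ∈ s, y i ≤ ∑ i ∈ s, (1 - y i) := by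
  classical
  induction s using Finset.induction_on with
  | empty => simp
  | insert a s ha ih =>
    have ih := ih (fun i hi => hy i (mem_insert_of_mem hi)) fun i hi => hy1 i (mem_insert_of_mem hi)
    have hprod : ∏ i ∈ s, y i ≤ 1 := prod_le_one (fun i hi => hy i (mem_insert_of_mem hi))
      fun i hi => hy1 i (mem_insert_of_mem hi)
    rw [prod_insert ha, sum_insert ha]
    nlinarith [hy1 a (mem_insert_self _ _)]

lemma Substochastic.Nbar_nonneg {M T : ℕ} {A : ℕ → ℕ → ℝ} (hA : Substochastic M T A) {x : ℕ}
    (hx : x ∈ Icc 1 M) : 0 ≤ Nbar A x T :=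
  sub_nonneg.2 (hA.2.1 x hx)

/-- `k` strategies over `T` rounds make at most `k * T` expected discoveries. -/
lemma sum_one_sub_prod_Nbar_le {M T k : ℕ} {F : Fin k → ℕ → ℕ → ℝ}
    (hF : ∀ i, Substochastic M T (F i)) :
    ∑ x ∈ Icc 1 M, (1 - ∏ i, Nbar (F i) x T) ≤ (T : ℝ) * k := by
  calc ∑ x ∈ Icc 1 M, (1 - ∏ i, Nbar (F i) x T)
      ≤ ∑ x ∈ Icc 1 M, ∑ i, ∑ t ∈ Icc 1 T, F i x t := by
        refine sum_le_sum fun x hx => ?_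
        simpa [Nbar] using one_sub_prod_le_sum univ (fun i => Nbar (F i) x T)
          (fun i _ => (hF i).Nbar_nonneg hx) fun i _ => Nbar_le_one (hF i).1 x T
    _ = ∑ t ∈ Icc 1 T, ∑ i, ∑ x ∈ Icc 1 M, F i x t := by
        rw [sum_comm' (t' := univ) (s' := fun _ => Icc 1 M) (by simp), sum_comm]
        simp only [sum_comm (s := Icc 1 M)]
        rw [sum_comm]
    _ ≤ ∑ t ∈ Icc 1 T, ∑ _i : Fin k, (1 : ℝ) :=
        sum_le_sum fun t ht => sum_le_sum fun i _ => (hF i).2.2 t ht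
    _ = T * k := by simp

/-- The price of anarchy bound for profiles indexed by the players. -/
lemma one_sub_pow_mul_sum_le {M T k : ℕ} (hk : 1 ≤ k) {f : ℕ → ℝ} (hf : ∀ x ∈ Icc 1 M, 0 ≤ f x)
    {F F' : Fin k → ℕ → ℕ → ℝ} (hF : ∀ i, Substochastic M T (F i))
    (hF' : ∀ i, Substochastic M T (F' i))
    (hnash : ∀ i B, Substochastic M T B →
      ∑ t ∈ Icc 1 T, ∑ x ∈ Icc 1 M, B x t * (f x * ∏ j ∈ univ.erase i, Nbar (F j) x t) ≤
        ∑ t ∈ Icc 1 T, ∑ x ∈ Icc 1 M, F i x t * (f x * ∏ j ∈ univ.erase i, Nbar (F j) x t)) :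
    (1 - (1 - 1 / (k : ℝ)) ^ k) * ∑ x ∈ Icc 1 M, f x * (1 - ∏ i, Nbar (F' i) x T)
      ≤ ∑ x ∈ Icc 1 M, f x * (1 - ∏ i, Nbar (F i) x T) := by
  have hF0 : ∀ i x t, 0 ≤ F i x t := fun i => (hF i).1
  have hbox := fun x (hx : x ∈ Icc 1 M) =>
    exists_box_deviation hk hF0 T fun i => (hF i).Nbar_nonneg hx
  choose! h h0 h1 hm hdev using hbox
  set m : ℕ → ℝ := fun x => ∑ t ∈ Icc 1 T, ∑ i, h x t * F i x t with hmdef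
  set r : ℕ → ℝ := fun x => 1 - ∏ i, Nbar (F' i) x T with hrdef
  have hr0 : ∀ x ∈ Icc 1 M, 0 ≤ r x := fun x hx => sub_nonneg.2 <|
    prod_le_one (fun i _ => (hF' i).Nbar_nonneg hx) fun i _ => Nbar_le_one (hF' i).1 x T
  have hr1 : ∀ x ∈ Icc 1 M, r x ≤ 1 := fun x hx => sub_le_self _ <|
    prod_nonneg fun i _ => (hF' i).Nbar_nonneg hx
  have hK0 : ∀ i, ∀ x ∈ Icc 1 M, ∀ t, 0 ≤ h x t * F i x t := fun i x hx t =>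
    mul_nonneg (h0 x hx t) (hF0 i x t)
  have hL0 : ∀ x ∈ Icc 1 M, 0 ≤ r x * (1 - m x) := fun x hx =>
    mul_nonneg (hr0 x hx) (sub_nonneg.2 (hm x hx))
  set slack : Fin k → ℕ → ℝ := fun i t => 1 - ∑ x ∈ Icc 1 M, r x * (h x t * F i x t) with hslack
  set S := ∑ t ∈ Icc 1 T, ∑ i, slack i t with hS
  set L := ∑ x ∈ Icc 1 M, r x * (1 - m x) with hL
  have hslack0 : ∀ i, ∀ t ∈ Icc 1 T, 0 ≤ slack i t := by
    intro i t ht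
    refine sub_nonneg.2 ((sum_le_sum fun x hx => ?_).trans ((hF i).2.2 t ht))
    calc r x * (h x t * F i x t) ≤ h x t * F i x t :=
          mul_le_of_le_one_left (hK0 i x hx t) (hr1 x hx)
      _ ≤ F i x t := mul_le_of_le_one_left (hF0 i x t) (h1 x hx t)
  have hS0 : 0 ≤ S := sum_nonneg fun t ht => sum_nonneg fun i _ => hslack0 i t ht
  have hLS : L ≤ S := by
    have hrsum : ∑ x ∈ Icc 1 M, r x ≤ (T : ℝ) * k := sum_one_sub_prod_Nbar_le hF'
    have hSeq : S = T * k - ∑ x ∈ Icc 1 M, r x * m x := by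
      have hcomm : ∑ x ∈ Icc 1 M, r x * m x
          = ∑ t ∈ Icc 1 T, ∑ i, ∑ x ∈ Icc 1 M, r x * (h x t * F i x t) := by
        simp only [hmdef, mul_sum]
        rw [sum_comm]
        exact sum_congr rfl fun t _ => sum_comm
      rw [hcomm]
      simp [hS, hslack, sum_sub_distrib]
    simp only [hL, mul_sub, mul_one, sum_sub_distrib]
    linarith
  set β : Fin k → ℕ → ℝ := fun i t => slack i t / S with hβ
  have hβ0 : ∀ i, ∀ t ∈ Icc 1 T, 0 ≤ β i t := fun i t ht => div_nonneg (hslack0 i t ht) hS0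
  have hβS : ∑ t ∈ Icc 1 T, ∑ i, β i t = S / S := by simp only [hβ, ← sum_div, hS]
  have hβ1 : ∀ x ∈ Icc 1 M, r x * (1 - m x) ≠ 0 → ∑ t ∈ Icc 1 T, ∑ i, β i t = 1 := by
    intro x hx hne
    have hpos : 0 < S := calc
      0 < r x * (1 - m x) := (hL0 x hx).lt_of_ne' hne
      _ ≤ L := single_le_sum hL0 hx
      _ ≤ S := hLS
    rw [hβS, div_self hpos.ne']
  set B : Fin k → ℕ → ℕ → ℝ := fun i x t =>
    if x ∈ Icc 1 M ∧ t ∈ Icc 1 T then r x * (h x t * F i x t) + r x * (1 - m x) * β i t else 0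
    with hB
  have hBin : ∀ i, ∀ x ∈ Icc 1 M, ∀ t ∈ Icc 1 T,
      B i x t = r x * (h x t * F i x t) + r x * (1 - m x) * β i t :=
    fun i x hx t ht => if_pos ⟨hx, ht⟩
  have hBsub : ∀ i, Substochastic M T (B i) := by
    intro i
    refine ⟨fun x t => ?_, fun x hx => ?_, fun t ht => ?_⟩
    · simp only [hB]
      split_ifs with hxt
      · exact add_nonneg (mul_nonneg (hr0 x hxt.1) (hK0 i x hxt.1 t))
          (mul_nonneg (hL0 x hxt.1) (hβ0 i t hxt.2))
      · exact le_rfl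
    · rw [sum_congr rfl fun t ht => hBin i x hx t ht, sum_add_distrib, ← mul_sum, ← mul_sum]
      have hKm : ∑ t ∈ Icc 1 T, h x t * F i x t ≤ m x := sum_le_sum fun t _ =>
        single_le_sum (f := fun i => h x t * F i x t) (fun j _ => hK0 j x hx t) (mem_univ i)
      have hβi : ∑ t ∈ Icc 1 T, β i t ≤ 1 :=
        (sum_le_sum fun t ht => single_le_sum (f := fun i => β i t)
          (fun j _ => hβ0 j t ht) (mem_univ i)).trans (hβS.trans_le (div_self_le_one S))
      nlinarith [mul_le_mul_of_nonneg_left hKm (hr0 x hx),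
        mul_le_mul_of_nonneg_left hβi (hL0 x hx), hr1 x hx]
    · rw [sum_congr rfl fun x hx => hBin i x hx t ht, sum_add_distrib, ← sum_mul]
      have hLβ : L * β i t ≤ slack i t := by
        rw [hβ, mul_div_left_comm]
        exact mul_le_of_le_one_right (hslack0 i t ht) (div_le_one_of_le₀ hLS hS0)
      simp only [hslack] at hLβ
      linarith
  have hgain : 0 ≤ ∑ i, (∑ t ∈ Icc 1 T, ∑ x ∈ Icc 1 M,
        F i x t * (f x * ∏ j ∈ univ.erase i, Nbar (F j) x t)
      - ∑ t ∈ Icc 1 T, ∑ x ∈ Icc 1 M, B i x t * (f x * ∏ j ∈ univ.erase i, Nbar (F j) x t)) :=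
    sum_nonneg fun i _ => sub_nonneg.2 (hnash i _ (hBsub i))
  have hgain_eq : ∑ i, (∑ t ∈ Icc 1 T, ∑ x ∈ Icc 1 M,
        F i x t * (f x * ∏ j ∈ univ.erase i, Nbar (F j) x t)
      - ∑ t ∈ Icc 1 T, ∑ x ∈ Icc 1 M, B i x t * (f x * ∏ j ∈ univ.erase i, Nbar (F j) x t))
      = ∑ x ∈ Icc 1 M, f x * ∑ t ∈ Icc 1 T, ∑ i, (F i x t - (r x * (h x t * F i x t)
          + r x * (1 - m x) * β i t)) * ∏ j ∈ univ.erase i, Nbar (F j) x t := by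
    simp only [mul_sum, ← sum_sub_distrib]
    rw [sum_comm, sum_comm (s := Icc 1 M)]
    refine sum_congr rfl fun t ht => ?_
    rw [sum_comm]
    refine sum_congr rfl fun x hx => sum_congr rfl fun i _ => ?_
    rw [hBin i x hx t ht]
    ring
  have hle := sum_le_sum fun x (hx : x ∈ Icc 1 M) => mul_le_mul_of_nonneg_left
    (hdev x hx (r x) β (hr0 x hx) (hr1 x hx) hβ0 (hβ1 x hx)) (hf x hx)
  have hsplit : ∑ x ∈ Icc 1 M,
      f x * (1 - ∏ i, Nbar (F i) x T - (1 - (1 - 1 / (k : ℝ)) ^ k) * r x)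
      = ∑ x ∈ Icc 1 M, f x * (1 - ∏ i, Nbar (F i) x T)
        - (1 - (1 - 1 / (k : ℝ)) ^ k) * ∑ x ∈ Icc 1 M, f x * r x := by
    rw [mul_sum, ← sum_sub_distrib]
    exact sum_congr rfl fun x _ => by ring
  rw [hgain_eq] at hgain
  linarith [hgain.trans (hle.trans_eq hsplit)]

lemma Multiset.exists_eq_map_univ {α : Type*} {k : ℕ} (P : Multiset α) (hP : P.card = k) :
    ∃ F : Fin k → α, P = (univ : Finset (Fin k)).val.map F := by
  obtain ⟨l, rfl⟩ : ∃ l : List α, P = l := ⟨P.toList, P.coe_toList.symm⟩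
  obtain rfl : l.length = k := hP
  exact ⟨l.get, by rw [Fin.univ_val_map, List.ofFn_get]⟩

/-- under the exclusive policy, the price of anarchy is at most
`(1 - (1 - 1/k)^k)⁻¹`: every profile of `k` strategies has success probability at most
`(1 - (1 - 1/k)^k)⁻¹` times that of any equilibrium profile of `k` strategies. -/
theorem exclusive_PoA_upper_bound
    (M T k : ℕ) (hM : 1 ≤ M) (hT : 1 ≤ T) (hk : 2 ≤ k)
    (f : ℕ → ℝ) (hf : BoxDist M f)
    (P : Multiset (ℕ → ℕ → ℝ)) (hcard : Multiset.card P = k)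
    (hsub : ∀ A ∈ P, Substochastic M T A)
    (hnash : ∀ A ∈ P, ∀ B, Substochastic M T B →
      pexUtil M T f (P.erase A) B ≤ pexUtil M T f (P.erase A) A)
    (P' : Multiset (ℕ → ℕ → ℝ)) (hcard' : Multiset.card P' = k)
    (hsub' : ∀ A ∈ P', Substochastic M T A) :
    success M T f P' ≤ (1 - (1 - 1 / (k : ℝ)) ^ k)⁻¹ * success M T f P := by
  obtain ⟨F, rfl⟩ := P.exists_eq_map_univ hcard
  obtain ⟨F', rfl⟩ := P'.exists_eq_map_univ hcard'
  have herase : ∀ i, ((univ : Finset (Fin k)).val.map F).erase (F i)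
      = (univ.erase i).val.map F := by
    intro i
    conv_lhs => rw [← insert_erase (mem_univ i), insert_val_of_notMem (notMem_erase i univ),
      Multiset.map_cons, Multiset.erase_cons_head]
  have hmain := one_sub_pow_mul_sum_le (M := M) (T := T) (f := f) (F := F) (F' := F')
    (by omega : 1 ≤ k) (fun x hx => (hf.1 x hx).le)
    (fun i => hsub _ (Multiset.mem_map_of_mem F (mem_univ_val i)))
    (fun i => hsub' _ (Multiset.mem_map_of_mem F' (mem_univ_val i)))
    (fun i B hB => by
      have h := hnash _ (Multiset.mem_map_of_mem F (mem_univ_val i)) B hB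
      rw [herase] at h
      simpa only [pexUtil, pexVal, Multiset.map_map, Function.comp_def, prod_map_val] using h)
  have hc : 0 < 1 - (1 - 1 / (k : ℝ)) ^ k := by
    have hk1 : (1 : ℝ) ≤ k := by exact_mod_cast (by omega : 1 ≤ k)
    have hinv : 1 / (k : ℝ) ≤ 1 := by rw [div_le_one (by linarith)]; exact hk1
    exact sub_pos.2 (pow_lt_one₀ (by linarith) (sub_lt_self _ (by positivity)) (by omega))
  rw [← div_eq_inv_mul, le_div_iff₀ hc, mul_comm]
  simpa only [success, Multiset.map_map, Function.comp_def, prod_map_val] using hmain
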